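/- Let G be a non-abelian finite simple group and let H be a maximal subgroup of G. Then there exists g ∈ G \ H such that H ∩ gHg⁻¹ is non-trivial; that is, H is not a Frobenius complement in G. -/

import Mathlib

open Representation

section
variable {G V : Type*} [Group G] [Fintype G] [AddCommGroup V] [Module ℂ V] [FiniteDimensional ℂ V]

open Matrix ComplexOrder in
theorem Representation.char_inv_eq_conj (ρ : Representation ℂ G V) (g : G) :
    ρ.character g⁻¹ = starRingEnd ℂ (ρ.character g) := by
  classical
  let b := Module.finBasis ℂ V
  let A : G → Matrix _ _ ℂ := fun g => LinearMap.toMatrix b b (ρ g)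
  have hA (x y : G) : A (x * y) = A x * A y := by
    simp only [A, map_mul, LinearMap.toMatrix_mul]
  have hA1 : A 1 = 1 := by simp [A]
  let P := ∑ x, (A x)ᴴ * A x
  have hP : P.PosDef := by
    have : P = (A 1)ᴴ * A 1 + ∑ x ∈ Finset.univ.erase 1, (A x)ᴴ * A x := by
      simp [P]
    rw [this, hA1]
    refine Matrix.PosDef.add_posSemidef (by simpa using Matrix.PosDef.one) ?_
    exact Matrix.posSemidef_sum _ fun x _ => Matrix.posSemidef_conjTranspose_mul_self _
  have hinv : (A g)ᴴ * P * A g = P := by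
    simp only [P, Finset.mul_sum, Finset.sum_mul]
    refine Fintype.sum_equiv (Equiv.mulRight g) _ _ fun x => ?_
    simp [hA, Matrix.mul_assoc]
  have hu : IsUnit P.det := (Matrix.isUnit_iff_isUnit_det _).1 hP.isUnit
  have hg : A g * A g⁻¹ = 1 := by rw [← hA, mul_inv_cancel, hA1]
  have hconj : A g⁻¹ = P⁻¹ * (A g)ᴴ * P := by
    calc A g⁻¹ = P⁻¹ * (P * A g⁻¹) := by
          rw [← Matrix.mul_assoc, Matrix.nonsing_inv_mul _ hu, one_mul]
      _ = P⁻¹ * ((A g)ᴴ * P * A g * A g⁻¹) := by rw [hinv]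
      _ = _ := by rw [Matrix.mul_assoc _ (A g), hg, mul_one, Matrix.mul_assoc]
  have htr (x : G) : ρ.character x = (A x).trace := LinearMap.trace_eq_matrix_trace ℂ b _
  rw [htr, htr, hconj, Matrix.trace_mul_comm, ← Matrix.mul_assoc,
    Matrix.mul_nonsing_inv _ hu, one_mul, Matrix.trace_conjTranspose]
  rfl

theorem Representation.char_leftRegular (k : Type*) [Field k] {g : G} (hg : g ≠ 1) :
    (leftRegular k G).character g = 0 := by
  classical
  let b : Module.Basis G k (MonoidAlgebra k G) := .ofRepr (MonoidAlgebra.coeffLinearEquiv k)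
  rw [Representation.character, LinearMap.trace_eq_matrix_trace k b, Matrix.trace]
  refine Finset.sum_eq_zero fun x _ => ?_
  have h : b x = MonoidAlgebra.single x 1 := rfl
  have h2 (v) : b.repr v = v.coeff := rfl
  simp [LinearMap.toMatrix_apply, h, h2, hg]

theorem Representation.exists_char_eq_add {k : Type*} [Field k] [NeZero (Nat.card G : k)]
    {V : Type*} [AddCommGroup V] [Module k V] [FiniteDimensional k V] (ρ : Representation k G V)
    [Nontrivial V] (hρ : ¬ ρ.IsIrreducible) :
    ∃ σ τ : Subrepresentation ρ,
      Module.finrank k σ.toSubmodule < Module.finrank k V ∧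
      Module.finrank k τ.toSubmodule < Module.finrank k V ∧
      ρ.character = σ.toRepresentation.character + τ.toRepresentation.character := by
  have hss : ρ.IsSemisimpleRepresentation := by
    rw [isSemisimpleRepresentation_iff_isSemisimpleModule_asModule]
    infer_instance
  have hnt : Nontrivial (Subrepresentation ρ) := by
    refine ⟨⊥, ⊤, fun h => ?_⟩
    exact bot_ne_top (α := Submodule k V) (congrArg Subrepresentation.toSubmodule h)
  obtain ⟨σ, hσb, hσt⟩ : ∃ σ : Subrepresentation ρ, σ ≠ ⊥ ∧ σ ≠ ⊤ := by
    by_contra! h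
    exact hρ ⟨fun σ => or_iff_not_imp_left.2 (h σ)⟩
  obtain ⟨τ, h⟩ := exists_isCompl σ
  have hc : IsCompl σ.toSubmodule τ.toSubmodule := by
    rw [isCompl_iff, disjoint_iff, codisjoint_iff] at h ⊢
    exact ⟨congrArg Subrepresentation.toSubmodule h.1, congrArg Subrepresentation.toSubmodule h.2⟩
  have hlt (π : Subrepresentation ρ) (hπ : π ≠ ⊤) :
      Module.finrank k π.toSubmodule < Module.finrank k V :=
    Submodule.finrank_lt fun h => hπ (Subrepresentation.toSubmodule_injective h)
  refine ⟨σ, τ, hlt σ hσt, hlt τ ?_, ?_⟩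
  · rintro rfl
    exact hσb (by simpa using h.inf_eq_bot)
  · ext g
    have hi := (DirectSum.isInternal_submodule_iff_isCompl
      (fun i : Bool => bif i then σ.toSubmodule else τ.toSubmodule) (i := true) (j := false)
      (by simp) (by ext i; cases i <;> simp)).2 hc
    have := LinearMap.trace_eq_sum_trace_restrict hi (f := ρ g) (by
      rintro (_ | _) v hv
      · exact τ.apply_mem_toSubmodule g hv
      · exact σ.apply_mem_toSubmodule g hv)
    rw [Fintype.sum_bool] at this
    exact this
end

section
variable {G : Type*} [Group G]

/-- The elements of `G` without non-trivial conjugates in `H`, and the identity. -/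
def Subgroup.frobeniusKernel (H : Subgroup G) : Set G :=
  {x | ∀ g : G, g⁻¹ * x * g ∈ H → x = 1}

/-- Conjugates of `H` by elements outside `H` meet `H` trivially. -/
def Subgroup.IsMalnormal (H : Subgroup G) : Prop :=
  ∀ g h : G, h ∈ H → h ≠ 1 → g * h * g⁻¹ ∈ H → g ∈ H

variable {H : Subgroup G}

theorem Subgroup.one_mem_frobeniusKernel : (1 : G) ∈ H.frobeniusKernel := fun _ _ => rfl

theorem Subgroup.IsMalnormal.zpow_mem_frobeniusKernel (hH : H.IsMalnormal) {k : G}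
    (hk : k ∈ H.frobeniusKernel) (j : ℤ) : k ^ j ∈ H.frobeniusKernel := by
  intro g hg
  by_contra hne
  have hmem : g⁻¹ * k * g ∈ H := by
    refine hH _ _ hg (fun h => hne ?_) ?_
    · have := congrArg (fun y => g * y * g⁻¹) h
      simpa [mul_assoc] using this
    · have : g⁻¹ * k * g * (g⁻¹ * k ^ j * g) * (g⁻¹ * k * g)⁻¹ = g⁻¹ * k ^ j * g := by
        have hc : k * k ^ j * k⁻¹ = k ^ j := by
          rw [mul_inv_eq_iff_eq_mul]; exact (Commute.self_zpow k j).eq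
        calc _ = g⁻¹ * (k * k ^ j * k⁻¹) * g := by group
          _ = _ := by rw [hc]
      rwa [this]
  exact hne (by rw [hk g hmem, one_zpow])

open scoped Classical in
theorem Subgroup.IsMalnormal.card_mul_sum [Fintype G] (hH : H.IsMalnormal) {R : Type*} [CommRing R]
    (f : G → R) (hf : ∀ g x, f (g * x * g⁻¹) = f x) :
    (Nat.card H : R) * ∑ x, f x = (Nat.card H : R) * ∑ x with x ∈ H.frobeniusKernel, f x +
      (Nat.card G : R) * (∑ h : H, f h - f 1) := by
  have hcount : (Nat.card H : R) * ∑ x with x ∉ H.frobeniusKernel, f x =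
      ∑ g : G, ∑ x with x ≠ 1 ∧ g⁻¹ * x * g ∈ H, f x := by
    simp only [Finset.sum_filter]
    rw [Finset.sum_comm, Finset.mul_sum]
    refine Finset.sum_congr rfl fun x _ => ?_
    by_cases hx : x ∈ H.frobeniusKernel
    · rw [if_neg (not_not.2 hx), mul_zero]
      exact (Finset.sum_eq_zero fun g _ => if_neg fun h => h.1 (hx g h.2)).symm
    · rw [if_pos hx]
      have hx' : ¬ ∀ g : G, g⁻¹ * x * g ∈ H → x = 1 := hx
      push Not at hx'
      obtain ⟨g₀, hg₀, hx1⟩ := hx'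
      rw [← Finset.sum_filter, Finset.sum_const, nsmul_eq_mul]
      congr 2
      rw [Nat.card_eq_fintype_card, ← Finset.card_univ]
      refine Finset.card_bij (fun h _ => g₀ * h) ?_ ?_ ?_
      · intro h _
        simp only [Finset.mem_filter, Finset.mem_univ, true_and]
        refine ⟨hx1, ?_⟩
        have := H.mul_mem (H.mul_mem (H.inv_mem h.2) hg₀) h.2
        convert this using 1
        group
      · intro a _ b _ hab
        exact Subtype.ext (mul_left_cancel hab)
      · intro g hg
        simp only [Finset.mem_filter, Finset.mem_univ, true_and] at hg
        have : g⁻¹ * g₀ ∈ H := by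
          refine hH _ _ hg₀ (fun h => hx1 ?_) ?_
          · have := congrArg (fun y => g₀ * y * g₀⁻¹) h
            simpa [mul_assoc] using this
          · convert hg.2 using 1
            group
        exact ⟨⟨g₀⁻¹ * g, by simpa using H.inv_mem this⟩, Finset.mem_univ _, by simp⟩
  have hinner (g : G) : ∑ x with x ≠ 1 ∧ g⁻¹ * x * g ∈ H, f x = ∑ h : H, f h - f 1 := by
    have h1 : ∑ h : H, f h - f 1 = ∑ h : H with h ≠ 1, f h := by
      rw [Finset.filter_ne', ← Finset.add_sum_erase _ _ (Finset.mem_univ (1 : H))]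
      simp
    rw [h1]
    symm
    refine Finset.sum_bij (fun h _ => g * h * g⁻¹) ?_ ?_ ?_ ?_
    · intro h hh
      simp only [Finset.mem_filter, Finset.mem_univ, true_and, ne_eq, conj_eq_one_iff] at hh ⊢
      refine ⟨by simpa [conj_eq_one_iff] using hh, ?_⟩
      simp [mul_assoc]
    · intro a _ b _ hab
      exact Subtype.ext (mul_left_cancel (mul_right_cancel hab))
    · intro x hx
      simp only [Finset.mem_filter, Finset.mem_univ, true_and] at hx
      refine ⟨⟨_, hx.2⟩, ?_, by simp [mul_assoc]⟩
      simp only [Finset.mem_filter, Finset.mem_univ, true_and, ne_eq, Subtype.ext_iff]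
      intro h
      refine hx.1 ?_
      have := congrArg (fun y => g * y * g⁻¹) h
      simpa [mul_assoc] using this
    · intro h _
      exact (hf g h).symm
  simp_rw [hinner] at hcount
  rw [Finset.sum_const, Finset.card_univ, nsmul_eq_mul, ← Nat.card_eq_fintype_card] at hcount
  rw [← hcount, ← mul_add, Finset.sum_filter_add_sum_filter_not]

theorem Subgroup.IsMalnormal.exists_ne_one_mem_frobeniusKernel [Finite G] (hH : H.IsMalnormal)
    (ht : H ≠ ⊤) : ∃ k ∈ H.frobeniusKernel, k ≠ 1 := by
  classical
  have := Fintype.ofFinite G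
  by_contra! h
  have hK : (Finset.univ.filter (· ∈ H.frobeniusKernel)) = {(1 : G)} := by
    ext x
    simp only [Finset.mem_filter, Finset.mem_univ, true_and, Finset.mem_singleton]
    exact ⟨h x, fun hx => hx ▸ one_mem_frobeniusKernel⟩
  have hs := hH.card_mul_sum (fun _ => (1 : ℤ)) (by simp)
  rw [hK] at hs
  simp only [Finset.sum_const, Finset.card_univ, ← Nat.card_eq_fintype_card,
    Finset.card_singleton, nsmul_eq_mul, mul_one, Nat.cast_one] at hs
  refine ht ((Subgroup.card_eq_iff_eq_top H).1 ?_)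
  have : (Nat.card H : ℤ) = Nat.card G := by linarith
  exact_mod_cast this
end

section
variable {G V : Type*} [Group G] [Fintype G] [AddCommGroup V] [Module ℂ V] [FiniteDimensional ℂ V]

theorem Representation.apply_eq_self_of_char_zpow (ρ : Representation ℂ G V) {g : G}
    (h : ∀ j : ℤ, ρ.character (g ^ j) = Module.finrank ℂ V) (v : V) : ρ g v = v := by
  classical
  let σ : Representation ℂ (Subgroup.zpowers g) V := ρ.comp (Subgroup.zpowers g).subtype
  have hσ (x : Subgroup.zpowers g) : σ.character x = Module.finrank ℂ V := by
    obtain ⟨_, j, rfl⟩ := x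
    exact h j
  let : Invertible (Nat.card (Subgroup.zpowers g) : ℂ) :=
    invertibleOfNonzero (by exact_mod_cast Nat.card_pos.ne')
  have hc := σ.card_inv_mul_sum_char_eq_finrank
  simp only [hσ, Finset.sum_const, Finset.card_univ, ← Nat.card_eq_fintype_card,
    nsmul_eq_mul] at hc
  rw [inv_mul_cancel_left₀ (by exact_mod_cast Nat.card_pos.ne')] at hc
  have htop : σ.invariants = ⊤ := Submodule.eq_top_of_finrank_eq (by exact_mod_cast hc.symm)
  have : v ∈ σ.invariants := htop ▸ Submodule.mem_top
  exact this ⟨g, Subgroup.mem_zpowers g⟩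

theorem Representation.IsIrreducible.invariants_eq_bot_or_eq_top {k : Type*} [Field k]
    {V : Type*} [AddCommGroup V] [Module k V] {G : Type*} [Group G] (ρ : Representation k G V)
    [ρ.IsIrreducible] :
    ρ.invariants = ⊥ ∨ ρ.invariants = ⊤ := by
  let σ : Subrepresentation ρ := ⟨ρ.invariants, fun g v hv => by rwa [hv g]⟩
  exact (eq_bot_or_eq_top σ).imp (congrArg Subrepresentation.toSubmodule)
    (congrArg Subrepresentation.toSubmodule)

variable {H : Subgroup G}

/-- The squared norms of `χ - m · reg` on `H` (with `m = ⟨χ, 1⟩_H`) and of `χ - c` on the Frobenius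
kernel (with `c` the mean of `χ` there) are proportional to `t` and `1 - t` for an integer `t`,
so one of the two vanishes. -/
theorem Subgroup.IsMalnormal.char_eq_zero_or_eq_finrank (hH : H.IsMalnormal)
    (ρ : Representation ℂ G V) [ρ.IsIrreducible] (hinv : ρ.invariants = ⊥) :
    (∀ h ∈ H, h ≠ 1 → ρ.character h = 0) ∨
      ∀ k ∈ H.frobeniusKernel, ρ.character k = Module.finrank ℂ V := by
  classical
  let : Invertible (Nat.card G : ℂ) := invertibleOfNonzero (by exact_mod_cast Nat.card_pos.ne')
  let : Invertible (Nat.card H : ℂ) := invertibleOfNonzero (by exact_mod_cast Nat.card_pos.ne')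
  let σ : Representation ℂ H V := ρ.comp H.subtype
  set χ := ρ.character with hχ
  have hχσ (h : H) : σ.character h = χ h := rfl
  set d := Module.finrank ℂ V
  set m := Module.finrank ℂ σ.invariants
  set M := Module.finrank ℂ (IntertwiningMap σ σ)
  set N := Nat.card H with hN
  have hNpos : (0 : ℝ) < N := by exact_mod_cast Nat.card_pos
  have hGpos : (0 : ℝ) < Nat.card G := by exact_mod_cast Nat.card_pos
  have hχ1 : χ 1 = d := ρ.char_one
  have hnormSq (g : G) : χ g * χ g⁻¹ = (Complex.normSq (χ g) : ℂ) := by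
    rw [hχ, ρ.char_inv_eq_conj, Complex.mul_conj]
  have hGsum : ∑ g, (χ g).re = 0 := by
    have h := ρ.card_inv_mul_sum_char_eq_finrank
    rw [hinv, finrank_bot, Nat.cast_zero, mul_eq_zero, or_iff_right (by simp)] at h
    rw [← Complex.re_sum, h, Complex.zero_re]
  have hGsq : ∑ g, Complex.normSq (χ g) = Nat.card G := by
    have h := ρ.char_orthonormal ρ
    rw [if_pos ⟨Representation.Equiv.refl ρ⟩, inv_mul_eq_one₀ (by simp)] at h
    simp only [← hχ, hnormSq] at h
    exact_mod_cast h.symm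
  have hHsum : ∑ h : H, (χ h).re = N * m := by
    have h := σ.card_inv_mul_sum_char_eq_finrank
    rw [inv_mul_eq_iff_eq_mul₀ (by simp)] at h
    simp only [hχσ] at h
    rw [← Complex.re_sum, h]
    simp [N, m]
  have hHsq : ∑ h : H, Complex.normSq (χ h) = N * M := by
    have h := σ.card_inv_mul_sum_char_mul_char_eq_finrank σ
    rw [inv_mul_eq_iff_eq_mul₀ (by simp)] at h
    simp only [hχσ, Subgroup.coe_inv, hnormSq] at h
    exact_mod_cast h
  have hconj (g x : G) : χ (g * x * g⁻¹) = χ x := ρ.char_conj x g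
  have hK1 := hH.card_mul_sum (fun g => (χ g).re) (by simp [hconj])
  have hK2 := hH.card_mul_sum (fun g => Complex.normSq (χ g)) (by simp [hconj])
  have hK0 := hH.card_mul_sum (fun _ => (1 : ℝ)) (by simp)
  simp only [hGsum, hGsq, hHsum, hHsq, hχ1, ← hN, Complex.natCast_re, Complex.normSq_natCast]
    at hK1 hK2
  simp only [Finset.sum_const, Finset.card_univ, ← Nat.card_eq_fintype_card, nsmul_eq_mul,
    mul_one, ← hN] at hK0
  set c : ℝ := d - N * m with hc
  set t : ℤ := M - 2 * d * m + N * m ^ 2 with ht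
  have hKt : ∑ x with x ∈ H.frobeniusKernel, Complex.normSq (χ x - c) =
      Nat.card G * (1 - t) := by
    have hexp (x : G) : Complex.normSq (χ x - c) =
        Complex.normSq (χ x) - 2 * c * (χ x).re + c ^ 2 := by
      simp [Complex.normSq_apply]; ring
    simp only [hexp, Finset.sum_add_distrib, Finset.sum_sub_distrib, ← Finset.mul_sum,
      Finset.sum_const, nsmul_eq_mul]
    refine mul_left_cancel₀ hNpos.ne' ?_
    rw [ht]
    push_cast
    linear_combination (-1 : ℝ) * hK2 + 2 * c * hK1 - c ^ 2 * hK0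
  have hHt : ∑ h : H with h ≠ 1, Complex.normSq (χ h) + c ^ 2 = N * t := by
    have := Finset.add_sum_erase Finset.univ (fun h : H => Complex.normSq (χ h))
      (Finset.mem_univ 1)
    rw [hHsq] at this
    simp only [OneMemClass.coe_one, hχ1, Complex.normSq_natCast] at this
    rw [Finset.filter_ne', ht]
    push_cast
    linear_combination this
  have hHnonneg : 0 ≤ ∑ h : H with h ≠ 1, Complex.normSq (χ h) :=
    Finset.sum_nonneg fun _ _ => Complex.normSq_nonneg _
  have ht0 : 0 ≤ t := by
    have : (0 : ℝ) ≤ t := nonneg_of_mul_nonneg_right (by rw [← hHt]; positivity) hNpos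
    exact_mod_cast this
  have ht1 : t ≤ 1 := by
    have : (0 : ℝ) ≤ 1 - t := nonneg_of_mul_nonneg_right
      (by rw [← hKt]; exact Finset.sum_nonneg fun _ _ => Complex.normSq_nonneg _) hGpos
    exact_mod_cast sub_nonneg.1 this
  obtain h | h : t = 0 ∨ t = 1 := by lia
  · left
    intro x hx hx1
    rw [h, Int.cast_zero, mul_zero] at hHt
    have hz : ∑ h : H with h ≠ 1, Complex.normSq (χ h) = 0 := by nlinarith [sq_nonneg c]
    rw [Finset.sum_eq_zero_iff_of_nonneg fun _ _ => Complex.normSq_nonneg _] at hz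
    exact Complex.normSq_eq_zero.1 (hz ⟨x, hx⟩ <|
      Finset.mem_filter.2 ⟨Finset.mem_univ _, fun h => hx1 (congrArg Subtype.val h)⟩)
  · right
    rw [h, Int.cast_one, sub_self, mul_zero,
      Finset.sum_eq_zero_iff_of_nonneg fun _ _ => Complex.normSq_nonneg _] at hKt
    have hKc (k : G) (hk : k ∈ H.frobeniusKernel) : χ k = c :=
      sub_eq_zero.1 (Complex.normSq_eq_zero.1 (hKt k (by simpa using hk)))
    intro k hk
    rw [hKc k hk, ← hKc 1 Subgroup.one_mem_frobeniusKernel, hχ1]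

theorem Subgroup.IsMalnormal.card_mul_char_eq_sum_of_isIrreducible [IsSimpleGroup G]
    (hH : H.IsMalnormal) (ht : H ≠ ⊤) (ρ : Representation ℂ G V) [ρ.IsIrreducible] {h : G}
    (hh : h ∈ H) (h1 : h ≠ 1) :
    (Nat.card G : ℂ) * ρ.character h = ∑ g, ρ.character g := by
  have htriv (hρ : ∀ g v, ρ g v = v) :
      (Nat.card G : ℂ) * ρ.character h = ∑ g, ρ.character g := by
    have hc (g : G) : ρ.character g = Module.finrank ℂ V := by
      rw [← ρ.char_one, Representation.character, Representation.character, map_one]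
      exact congrArg _ (LinearMap.ext (hρ g))
    simp [hc]
  obtain hinv | hinv := Representation.IsIrreducible.invariants_eq_bot_or_eq_top ρ
  · obtain hz | hK := hH.char_eq_zero_or_eq_finrank ρ hinv
    · let : Invertible (Nat.card G : ℂ) :=
        invertibleOfNonzero (by exact_mod_cast Nat.card_pos.ne')
      have hs := ρ.card_inv_mul_sum_char_eq_finrank
      rw [hinv, finrank_bot, Nat.cast_zero, mul_eq_zero, or_iff_right (by simp)] at hs
      rw [hz h hh h1, hs, mul_zero]
    · obtain ⟨k, hk, hk1⟩ := hH.exists_ne_one_mem_frobeniusKernel ht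
      have hker : k ∈ ρ.ker := LinearMap.ext <|
        ρ.apply_eq_self_of_char_zpow fun j => hK _ (hH.zpow_mem_frobeniusKernel hk j)
      have htop : ρ.ker = ⊤ := ρ.normal_ker.eq_bot_or_eq_top.resolve_left fun hb =>
        hk1 (Subgroup.mem_bot.1 (hb ▸ hker))
      refine htriv fun g v => ?_
      have : g ∈ ρ.ker := htop ▸ Subgroup.mem_top g
      exact LinearMap.congr_fun this v
  · refine htriv fun g v => ?_
    have : v ∈ ρ.invariants := hinv ▸ Submodule.mem_top
    exact this g

theorem Subgroup.IsMalnormal.card_mul_char_eq_sum [IsSimpleGroup G]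
    (hH : H.IsMalnormal) (ht : H ≠ ⊤) (ρ : Representation ℂ G V) {h : G}
    (hh : h ∈ H) (h1 : h ≠ 1) :
    (Nat.card G : ℂ) * ρ.character h = ∑ g, ρ.character g := by
  induction hn : Module.finrank ℂ V using Nat.strong_induction_on generalizing V with
  | _ n ih =>
    subst hn
    by_cases hirr : ρ.IsIrreducible
    · exact hH.card_mul_char_eq_sum_of_isIrreducible ht ρ hh h1
    · obtain hV | hV := subsingleton_or_nontrivial V
      · have hz (g : G) : ρ.character g = 0 := by
          rw [Representation.character, Subsingleton.elim (ρ g) 0, map_zero]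
        simp [hz]
      · obtain ⟨σ, τ, hσ, hτ, hχ⟩ := ρ.exists_char_eq_add hirr
        simp only [hχ, Pi.add_apply, mul_add, Finset.sum_add_distrib]
        rw [ih _ hσ σ.toRepresentation rfl, ih _ hτ τ.toRepresentation rfl]

/-- A weak form of **Frobenius' theorem**: a finite simple group has no non-trivial Frobenius
complement. -/
theorem Subgroup.IsMalnormal.eq_bot_of_isSimpleGroup [IsSimpleGroup G] (hH : H.IsMalnormal)
    (ht : H ≠ ⊤) : H = ⊥ := by
  refine (Subgroup.eq_bot_iff_forall H).2 fun h hh => ?_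
  by_contra h1
  have hs := hH.card_mul_char_eq_sum ht (leftRegular ℂ G) hh h1
  rw [Representation.char_leftRegular ℂ h1, mul_zero,
    Fintype.sum_eq_single 1 fun g hg => Representation.char_leftRegular ℂ hg,
    Representation.char_one] at hs
  have : Module.finrank ℂ (MonoidAlgebra ℂ G) = 0 := by exact_mod_cast hs.symm
  rw [Module.finrank_zero_iff] at this
  exact not_subsingleton (MonoidAlgebra ℂ G) this
end

/-- Let `G` be a non-abelian finite simple group and `H` a maximal subgroup of `G`.  Then
there is `g ∈ G \ H` with `H ∩ gHg⁻¹` non-trivial; that is, `H` is not a Frobenius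
complement in `G`. -/
theorem maximal_subgroup_not_frobenius_complement (G : Type) [Group G] [Finite G]
    [IsSimpleGroup G] (hna : ¬ ∀ a b : G, a * b = b * a)
    (H : Subgroup G) (hH : IsCoatom H) :
    ∃ g : G, g ∉ H ∧ H ⊓ Subgroup.map (MulAut.conj g).toMonoidHom H ≠ ⊥ := by
  by_contra! hF
  have := Fintype.ofFinite G
  have hmal : H.IsMalnormal := by
    intro g h hh h1 hgh
    by_contra hg
    have hmem : g * h * g⁻¹ ∈ H ⊓ Subgroup.map (MulAut.conj g).toMonoidHom H :=
      ⟨hgh, h, hh, rfl⟩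
    rw [hF g hg, Subgroup.mem_bot, conj_eq_one_iff] at hmem
    exact h1 hmem
  obtain rfl := hmal.eq_bot_of_isSimpleGroup hH.1
  obtain ⟨x, hx⟩ := exists_ne (1 : G)
  have htop : Subgroup.zpowers x = ⊤ :=
    hH.2 _ (bot_lt_iff_ne_bot.2 (by simpa using hx))
  refine hna fun a b => ?_
  obtain ⟨i, rfl⟩ : a ∈ Subgroup.zpowers x := htop ▸ Subgroup.mem_top a
  obtain ⟨j, rfl⟩ : b ∈ Subgroup.zpowers x := htop ▸ Subgroup.mem_top b
  exact (Commute.refl x).zpow_zpow i j
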